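/- Let u : 𝕋 × [0,∞) → ℝ be C¹ with u and ∂_x u square-integrable on 𝕋 × (0,∞), define v(x,Y) = −∫₀^Y ∂_x u(x,Y') dY', and let R > 0. Then for every C¹ function φ : 𝕋 × [0,∞) → ℝ whose support is contained in 𝕋 × [0,R], one has | ∫_{𝕋×(0,∞)} ( u(x,Y)² ∂_x φ(x,Y) + u(x,Y) v(x,Y) ∂_Y φ(x,Y) ) dY dx | ≤ sup(|∂_x φ| + |∂_Y φ|) · ( ‖u‖²_{L²(𝕋×(0,∞))} + R · ‖u‖_{L²(𝕋×(0,∞))} ‖∂_x u‖_{L²(𝕋×(0,∞))} ). -/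

import Mathlib

open MeasureTheory

/-- Cauchy–Schwarz on an interval: `(∫ f)² ≤ length · ∫ f²`. -/
lemma sq_intervalIntegral_le_mul_intervalIntegral_sq {f : ℝ → ℝ} (hf : Continuous f) {Y : ℝ}
    (hY : 0 < Y) : (∫ y in (0 : ℝ)..Y, f y) ^ 2 ≤ Y * ∫ y in (0 : ℝ)..Y, f y ^ 2 := by
  set m := ∫ y in (0 : ℝ)..Y, f y with hm
  have hnonneg : 0 ≤ ∫ y in (0 : ℝ)..Y, (Y * f y - m) ^ 2 :=
    intervalIntegral.integral_nonneg hY.le fun y _ => sq_nonneg _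
  have hexpand : ∫ y in (0 : ℝ)..Y, (Y * f y - m) ^ 2
      = Y * (Y * (∫ y in (0 : ℝ)..Y, f y ^ 2) - m ^ 2) := by
    have hpt : ∀ y, (Y * f y - m) ^ 2 = Y ^ 2 * f y ^ 2 - 2 * Y * m * f y + m ^ 2 := fun y => by
      ring
    simp only [hpt]
    rw [intervalIntegral.integral_add, intervalIntegral.integral_sub,
      intervalIntegral.integral_const_mul, intervalIntegral.integral_const_mul,
      intervalIntegral.integral_const, ← hm]
    · simp only [smul_eq_mul]
      ring
    all_goals exact Continuous.intervalIntegrable (by fun_prop) _ _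
  rw [hexpand] at hnonneg
  linarith [nonneg_of_mul_nonneg_right hnonneg hY]

/-- Optimising the parameter in Young's inequality, with degenerate cases included. -/
lemma le_mul_add_mul_sqrt_of_forall_young {X S A B R : ℝ} (hS : 0 ≤ S) (hA : 0 ≤ A) (hB : 0 ≤ B)
    (hR : 0 ≤ R) (h : ∀ t, 0 < t → X ≤ S * (A + (t * A + R ^ 2 * B / t) / 2)) :
    X ≤ S * (A + R * √A * √B) := by
  set a := √A
  set b := √B
  have ha : 0 ≤ a := Real.sqrt_nonneg _
  have hb : 0 ≤ b := Real.sqrt_nonneg _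
  have hAa : A = a * a := (Real.mul_self_sqrt hA).symm
  have hBb : B = b * b := (Real.mul_self_sqrt hB).symm
  have hε : ∀ ε : ℝ, 0 < ε → X ≤ S * (A + (a * (R * b + ε) + R * b * (a + ε)) / 2) := by
    intro ε hε
    have hRb : 0 ≤ R * b := mul_nonneg hR hb
    have h1 : (R * b + ε) / (a + ε) * A ≤ a * (R * b + ε) := by
      rw [div_mul_eq_mul_div, div_le_iff₀ (by positivity), hAa]
      nlinarith [mul_nonneg (mul_nonneg ha hε.le) (add_nonneg hRb hε.le)]
    have h2 : R ^ 2 * B / ((R * b + ε) / (a + ε)) ≤ R * b * (a + ε) := by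
      rw [div_div_eq_mul_div, div_le_iff₀ (by positivity), hBb]
      nlinarith [mul_nonneg (mul_nonneg hRb hε.le) (add_nonneg ha hε.le)]
    refine (h ((R * b + ε) / (a + ε)) (by positivity)).trans ?_
    gcongr
  have hlim : Filter.Tendsto
      (fun ε : ℝ => S * (A + (a * (R * b + ε) + R * b * (a + ε)) / 2))
      (nhdsWithin 0 (Set.Ioi 0)) (nhds (S * (A + R * a * b))) := by
    have hcont : Continuous
        (fun ε : ℝ => S * (A + (a * (R * b + ε) + R * b * (a + ε)) / 2)) := by fun_prop
    have h0 := (hcont.tendsto 0).mono_left (nhdsWithin_le_nhds (s := Set.Ioi 0))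
    convert h0 using 2
    ring
  exact ge_of_tendsto hlim (eventually_nhdsWithin_of_forall hε)

/-- A partial derivative of a `C¹` function of two variables is continuous in the
other variable. -/
lemma continuous_of_hasDerivAt_fst {u ux : ℝ → ℝ → ℝ}
    (hC1 : ContDiff ℝ 1 (fun p : ℝ × ℝ => u p.1 p.2))
    (hux : ∀ x Y, HasDerivAt (fun x' => u x' Y) (ux x Y) x) (x : ℝ) : Continuous (ux x) := by
  have heq : ux x = fun Y => fderiv ℝ (fun p : ℝ × ℝ => u p.1 p.2) (x, Y) (1, 0) := by
    funext Y
    have hF := (hC1.differentiable one_ne_zero (x, Y)).hasFDerivAt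
    have hline : HasDerivAt (fun x' : ℝ => (x', Y)) ((1 : ℝ), (0 : ℝ)) x :=
      (hasDerivAt_id x).prodMk (hasDerivAt_const x Y)
    exact (hux x Y).unique (hF.comp_hasDerivAt (f := fun x' : ℝ => (x', Y)) x hline)
  rw [heq]
  have hc := hC1.continuous_fderiv one_ne_zero
  fun_prop

lemma integrable_and_integral_mul_add_young {α : Type*} [MeasurableSpace α] {μ : Measure α}
    {f g : α → ℝ} (hf : Integrable f μ) (hg : Integrable g μ) (S t : ℝ) :
    Integrable (fun x => S * (f x + (t * f x + g x) / 2)) μ ∧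
      ∫ x, S * (f x + (t * f x + g x) / 2) ∂μ
        = S * ((∫ x, f x ∂μ) + (t * (∫ x, f x ∂μ) + ∫ x, g x ∂μ) / 2) := by
  have h1 : Integrable (fun x => t * f x + g x) μ := (hf.const_mul t).add hg
  refine ⟨(hf.add (h1.div_const 2)).const_mul S, ?_⟩
  rw [integral_const_mul, integral_add hf (h1.div_const 2), integral_div,
    integral_add (hf.const_mul t) hg, integral_const_mul]

/-- With `u` `C¹` on `𝕋 × [0,∞)` (modelled by a `1`-periodic
function in `x`), `u, ∂ₓu ∈ L²(𝕋 × (0,∞))`, `v(x,Y) = -∫₀^Y ∂ₓu(x,Y')dY'`, and a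
`C¹` test function `φ` supported in `𝕋 × [0,R]`, the weak form of the Prandtl
nonlinearity is controlled quadratically by the `H¹` norm of `u`:
`|∫∫ (u² ∂ₓφ + u v ∂_Y φ)| ≤ sup(|∂ₓφ| + |∂_Y φ|) (‖u‖² + R ‖u‖ ‖∂ₓu‖)`. -/
theorem prandtl_nonlinearity_distributional_bound
    (u ux : ℝ → ℝ → ℝ)
    (huper : ∀ x Y, u (x + 1) Y = u x Y)
    (hC1 : ContDiff ℝ 1 (fun p : ℝ × ℝ => u p.1 p.2))
    (hux : ∀ x Y, HasDerivAt (fun x' => u x' Y) (ux x Y) x)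
    (huL2 : IntegrableOn (fun p : ℝ × ℝ => u p.1 p.2 ^ 2)
      (Set.Ioc (0 : ℝ) 1 ×ˢ Set.Ioi (0 : ℝ)))
    (huxL2 : IntegrableOn (fun p : ℝ × ℝ => ux p.1 p.2 ^ 2)
      (Set.Ioc (0 : ℝ) 1 ×ˢ Set.Ioi (0 : ℝ)))
    (v : ℝ → ℝ → ℝ)
    (hv : ∀ x Y, v x Y = -∫ Y' in (0 : ℝ)..Y, ux x Y')
    (R : ℝ) (hR : 0 < R)
    (φ φx φY : ℝ → ℝ → ℝ)
    (hφper : ∀ x Y, φ (x + 1) Y = φ x Y)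
    (hφC1 : ContDiff ℝ 1 (fun p : ℝ × ℝ => φ p.1 p.2))
    (hφx : ∀ x Y, HasDerivAt (fun x' => φ x' Y) (φx x Y) x)
    (hφY : ∀ x Y, HasDerivAt (fun Y' => φ x Y') (φY x Y) Y)
    (hφsupp : ∀ x Y, R < Y → φ x Y = 0)
    (S : ℝ) (hS : ∀ x Y, |φx x Y| + |φY x Y| ≤ S) :
    |∫ x in Set.Ioc (0 : ℝ) 1, ∫ Y in Set.Ioi (0 : ℝ),
        (u x Y ^ 2 * φx x Y + u x Y * v x Y * φY x Y)|
      ≤ S * ((∫ x in Set.Ioc (0 : ℝ) 1, ∫ Y in Set.Ioi (0 : ℝ), u x Y ^ 2)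
          + R * Real.sqrt (∫ x in Set.Ioc (0 : ℝ) 1, ∫ Y in Set.Ioi (0 : ℝ), u x Y ^ 2)
              * Real.sqrt (∫ x in Set.Ioc (0 : ℝ) 1, ∫ Y in Set.Ioi (0 : ℝ), ux x Y ^ 2)) := by
  have hS0 : 0 ≤ S := (by positivity : (0 : ℝ) ≤ |φx 0 0| + |φY 0 0|).trans (hS 0 0)
  rw [IntegrableOn, Measure.volume_eq_prod, ← Measure.prod_restrict] at huL2 huxL2
  have hIu := huL2.integral_prod_left
  have hIux := huxL2.integral_prod_left
  have hφY0 : ∀ x Y, R < Y → φY x Y = 0 := fun x Y hY => by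
    refine (hφY x Y).unique ((hasDerivAt_const Y (0 : ℝ)).congr_of_eventuallyEq ?_)
    filter_upwards [lt_mem_nhds hY] with Y' hY' using hφsupp x Y' hY'
  refine le_mul_add_mul_sqrt_of_forall_young hS0
    (integral_nonneg fun x => integral_nonneg fun Y => sq_nonneg _)
    (integral_nonneg fun x => integral_nonneg fun Y => sq_nonneg _) hR.le fun t ht => ?_
  have hslice : ∀ᵐ x ∂(volume.restrict (Set.Ioc (0 : ℝ) 1)),
      ‖∫ Y in Set.Ioi (0 : ℝ), (u x Y ^ 2 * φx x Y + u x Y * v x Y * φY x Y)‖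
        ≤ S * ((∫ Y in Set.Ioi (0 : ℝ), u x Y ^ 2)
          + (t * (∫ Y in Set.Ioi (0 : ℝ), u x Y ^ 2)
            + R ^ 2 * (∫ Y in Set.Ioi (0 : ℝ), ux x Y ^ 2) / t) / 2) := by
    filter_upwards [huL2.prod_right_ae, huxL2.prod_right_ae] with x hxu hxux
    set b := ∫ Y in Set.Ioi (0 : ℝ), ux x Y ^ 2
    have hb : 0 ≤ b := integral_nonneg fun Y => sq_nonneg _
    have hv2 : ∀ Y, 0 < Y → Y ≤ R → v x Y ^ 2 ≤ R * b := by
      intro Y hY hYR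
      rw [hv, neg_sq]
      refine (sq_intervalIntegral_le_mul_intervalIntegral_sq
        (continuous_of_hasDerivAt_fst hC1 hux x) hY).trans ?_
      rw [intervalIntegral.integral_of_le hY.le]
      have hmono : ∫ y in Set.Ioc 0 Y, ux x y ^ 2 ≤ b :=
        setIntegral_mono_set hxux (Filter.Eventually.of_forall fun _ => sq_nonneg _)
          Set.Ioc_subset_Ioi_self.eventuallyLE
      exact mul_le_mul hYR hmono (integral_nonneg fun _ => sq_nonneg _) hR.le
    have hind : Integrable ((Set.Ioc 0 R).indicator fun _ : ℝ => R * b / t)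
        (volume.restrict (Set.Ioi (0 : ℝ))) :=
      ((integrableOn_const (by simp)).integrable_indicator measurableSet_Ioc).restrict
    have hmaj := integrable_and_integral_mul_add_young hxu hind S t
    refine (norm_integral_le_of_norm_le hmaj.1 ?_).trans_eq ?_
    · filter_upwards [ae_restrict_mem measurableSet_Ioi] with Y hY
      have hx := abs_nonneg (φx x Y)
      have hy := abs_nonneg (φY x Y)
      have h1 : u x Y ^ 2 * |φx x Y| ≤ u x Y ^ 2 * S := by
        gcongr
        linarith [hS x Y]
      have h2 : |u x Y * v x Y| * |φY x Y| ≤ S * ((t * u x Y ^ 2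
          + (Set.Ioc 0 R).indicator (fun _ => R * b / t) Y) / 2) := by
        rcases le_or_gt Y R with hYR | hYR
        · rw [Set.indicator_of_mem (Set.mem_Ioc.2 ⟨hY, hYR⟩), mul_comm]
          have hyoung : |u x Y * v x Y| ≤ (t * u x Y ^ 2 + R * b / t) / 2 := by
            have hdiv : v x Y ^ 2 / t ≤ R * b / t := by
              gcongr
              exact hv2 Y hY hYR
            have hsq : t * u x Y ^ 2 + v x Y ^ 2 / t - 2 * |u x Y * v x Y|
                = (t * |u x Y| - |v x Y|) ^ 2 / t := by
              rw [abs_mul, ← sq_abs (u x Y), ← sq_abs (v x Y)]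
              field_simp
              ring
            have hpos : 0 ≤ (t * |u x Y| - |v x Y|) ^ 2 / t := by positivity
            linarith
          exact mul_le_mul (by linarith [hS x Y]) hyoung (abs_nonneg _) hS0
        · rw [hφY0 x Y hYR, Set.indicator_of_notMem fun h => hYR.not_ge h.2]
          simp only [abs_zero, mul_zero]
          positivity
      rw [Real.norm_eq_abs]
      refine (abs_add_le _ _).trans ?_
      rw [abs_mul, abs_mul (u x Y * v x Y), abs_of_nonneg (sq_nonneg (u x Y))]
      linarith
    · rw [hmaj.2, setIntegral_indicator measurableSet_Ioc,
        Set.inter_eq_right.2 Set.Ioc_subset_Ioi_self, setIntegral_const]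
      simp only [measureReal_def, Real.volume_Ioc, sub_zero, ENNReal.toReal_ofReal hR.le,
        smul_eq_mul]
      ring
  have hmaj := integrable_and_integral_mul_add_young hIu ((hIux.const_mul (R ^ 2)).div_const t) S t
  refine (norm_integral_le_of_norm_le hmaj.1 hslice).trans_eq ?_
  rw [hmaj.2, integral_div, integral_const_mul]
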